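/- Assume conditions (A2)–(A4). Then {P_t}_{t≥0} possesses a unique invariant probability measure μ_* (i.e. μ_* P_t = μ_* for all t ≥ 0), and μ_* has finite ζ-th moment: ∫_X ρ(x₀,x)^ζ μ_*(dx) < ∞. Moreover, {P_t}_{t≥0} is asymptotically stable, i.e. νP_t converges weakly to μ_* as t → ∞ for every Borel probability measure ν on X, and there exists C > 0 such that d_W(νP_t, μ_*) ≤ C e^{−γt}(∫ V dν + 1) for every t ≥ 0 and every probability measure ν with finite first moment. -/

import Mathlib

open MeasureTheory Filter Set
open scoped ENNReal Topology NNReal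

noncomputable section

variable {X : Type*} [MetricSpace X] [CompleteSpace X] [SecondCountableTopology X]
  [MeasurableSpace X] [BorelSpace X]

/-- Action of a transition kernel family on measures: `ν ↦ ν P_t`. -/
def measAct (P : ℝ → X → Measure X) (t : ℝ) (ν : Measure X) : Measure X :=
  ν.bind (P t)

/-- Dual action of the semigroup on functions: `f ↦ P_t f`. -/
def funAct (P : ℝ → X → Measure X) (t : ℝ) (f : X → ℝ) (x : X) : ℝ :=
  ∫ y, f y ∂(P t x)

/-- A Borel (probability) measure has a finite first moment. -/
def FiniteFirstMoment (ν : Measure X) : Prop :=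
  ∀ x₀ : X, Integrable (fun x => dist x₀ x) ν

/-- The Wasserstein (Kantorovich–Rubinstein) distance `d_W`. -/
def wassDist (μ ν : Measure X) : ℝ :=
  sSup {r | ∃ f : X → ℝ, LipschitzWith 1 f ∧ r = |(∫ x, f x ∂μ) - ∫ x, f x ∂ν|}

/-- A Markov semigroup `{P_t}_{t ≥ 0}` of probability kernels on `X`. -/
structure IsMarkovSemigroup (P : ℝ → X → Measure X) : Prop where
  prob : ∀ t, 0 ≤ t → ∀ x, IsProbabilityMeasure (P t x)
  jointMeas : ∀ A : Set X, MeasurableSet A → Measurable fun p : ℝ × X => P p.1 p.2 A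
  init : ∀ x, P 0 x = Measure.dirac x
  chapman : ∀ s t, 0 ≤ s → 0 ≤ t → ∀ x, P (s + t) x = (P s x).bind (P t)

/-- Condition (A1): stochastic continuity of the semigroup. -/
def CondA1 (P : ℝ → X → Measure X) : Prop :=
  ∀ f : X → ℝ, Continuous f → (∃ C, ∀ x, |f x| ≤ C) →
    ∀ x : X, Tendsto (fun t => funAct P t f x) (𝓝[>] (0 : ℝ)) (𝓝 (f x))

/-- Condition (A2): the Feller property. -/
def CondA2 (P : ℝ → X → Measure X) : Prop :=
  ∀ f : X → ℝ, Continuous f → (∃ C, ∀ x, |f x| ≤ C) → ∀ t, 0 ≤ t →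
    Continuous (funAct P t f) ∧ ∃ C, ∀ x, |funAct P t f x| ≤ C

/-- Condition (A3): preservation of finite first moments and exponential
contractivity in the Wasserstein distance, with rate `γ`. -/
def CondA3 (P : ℝ → X → Measure X) (γ : ℝ) : Prop :=
  (∀ ν : Measure X, IsProbabilityMeasure ν → FiniteFirstMoment ν →
    ∀ t, 0 < t → FiniteFirstMoment (measAct P t ν)) ∧
  0 < γ ∧
  ∀ t, 0 ≤ t → ∀ x y : X,
    wassDist (P t x) (P t y) ≤ Real.exp (-γ * t) * dist x y

/-- Condition (A4): a uniform-in-time moment bound of order `ζ > 2` for the initial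
distribution `μ`, along the semigroup. -/
def CondA4 (P : ℝ → X → Measure X) (μ : Measure X) (x₀ : X) (ζ : ℝ) : Prop :=
  2 < ζ ∧ ∃ M : ℝ, ∀ t, 0 ≤ t →
    (∫⁻ x, ENNReal.ofReal (dist x₀ x ^ ζ) ∂(measAct P t μ)) ≤ ENNReal.ofReal M

variable {Ω : Type*} [MeasurableSpace Ω]

/-- The natural filtration of the process `Φ`. -/
def natFiltration (Φ : ℝ → Ω → X) (s : ℝ) : MeasurableSpace Ω :=
  ⨆ u ∈ Set.Icc (0 : ℝ) s, MeasurableSpace.comap (Φ u) inferInstance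

/-- A (progressively measurable) time-homogeneous Markov process with state space `X`,
transition semigroup `P` and initial distribution `μ`, realized on `(Ω, ℙ)`. -/
structure IsMarkovProcess (P : ℝ → X → Measure X) (Φ : ℝ → Ω → X)
    (ℙ : Measure Ω) (μ : Measure X) : Prop where
  jointMeas : Measurable fun p : ℝ × Ω => Φ p.1 p.2
  init : ℙ.map (Φ 0) = μ
  law : ∀ t, 0 ≤ t → ℙ.map (Φ t) = measAct P t μ
  markov : ∀ f : X → ℝ, Measurable f → (∃ C, ∀ x, |f x| ≤ C) →
    ∀ s t : ℝ, 0 ≤ s → 0 ≤ t →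
      (fun ω => funAct P t f (Φ s ω)) =ᵐ[ℙ]
        ℙ[(fun ω => f (Φ (s + t) ω)) | natFiltration Φ s]

/-- A Markov process together with a measurable family of laws `{ℙ_x}_{x ∈ X}`,
with `ℙ_x(Φ_0 = x) = 1`. -/
structure IsMarkovFamily (P : ℝ → X → Measure X) (Φ : ℝ → Ω → X)
    (ℙ : X → Measure Ω) : Prop where
  prob : ∀ x, IsProbabilityMeasure (ℙ x)
  jointMeas : Measurable fun p : ℝ × Ω => Φ p.1 p.2
  measFam : ∀ s : Set Ω, MeasurableSet s → Measurable fun x => ℙ x s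
  start : ∀ x, (ℙ x) {ω | Φ 0 ω = x} = 1
  law : ∀ x, ∀ t, 0 ≤ t → (ℙ x).map (Φ t) = P t x
  markov : ∀ x : X, ∀ f : X → ℝ, Measurable f → (∃ C, ∀ z, |f z| ≤ C) →
    ∀ s t : ℝ, 0 ≤ s → 0 ≤ t →
      (fun ω => funAct P t f (Φ s ω)) =ᵐ[ℙ x]
        (ℙ x)[(fun ω => f (Φ (s + t) ω)) | natFiltration Φ s]

/-- The corrector function `χ_g(x) = ∫_0^∞ (P_t g)(x) dt`. -/
def corrector (P : ℝ → X → Measure X) (g : X → ℝ) (x : X) : ℝ :=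
  ∫ t in Set.Ioi (0 : ℝ), funAct P t g x

/-- The additive functional `I_t(g) = ∫_0^t g(Φ_s) ds`. -/
def addFun (g : X → ℝ) (Φ : ℝ → Ω → X) (t : ℝ) (ω : Ω) : ℝ :=
  ∫ s in (0 : ℝ)..t, g (Φ s ω)

/-- The martingale part `M_t(g) = χ_g(Φ_t) - χ_g(Φ_0) + I_t(g)`. -/
def mart (P : ℝ → X → Measure X) (g : X → ℝ) (Φ : ℝ → Ω → X) (t : ℝ) (ω : Ω) : ℝ :=
  corrector P g (Φ t ω) - corrector P g (Φ 0 ω) + addFun g Φ t ω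

/-- The martingale increments `Z_n(g) = M_n(g) - M_{n-1}(g)`. -/
def incr (P : ℝ → X → Measure X) (g : X → ℝ) (Φ : ℝ → Ω → X) (n : ℕ) (ω : Ω) : ℝ :=
  mart P g Φ (n : ℝ) ω - mart P g Φ ((n : ℝ) - 1) ω

/-- Truncation `a ∧ p` for `p ∈ ℕ ∪ {∞}`, with the convention `a ∧ ∞ = a`. -/
def truncMin (a : ℝ) (p : ℕ∞) : ℝ :=
  if p = ⊤ then a else min a (p.toNat : ℝ)


lemma aux_tight_step (x₀ : X) (m : ℕ → Measure X) (hm : ∀ n, IsProbabilityMeasure (m n))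
    (hC : ∀ ε : ℝ, 0 < ε → ∃ N : ℕ, ∀ n, N ≤ n → ∀ f : X → ℝ, LipschitzWith 1 f →
      (∃ C, ∀ x, |f x| ≤ C) → |(∫ x, f x ∂(m n)) - ∫ x, f x ∂(m N)| ≤ ε)
    (δ ε : ℝ) (hδ : 0 < δ) (hε : 0 < ε) :
    ∃ K : Set X, IsCompact K ∧ ∀ n, m n (Metric.thickening δ K)ᶜ ≤ ENNReal.ofReal ε := by
  obtain ⟨N, hN⟩ := hC (δ * (ε / 2)) (by positivity)
  have htight : ∀ i, ∃ K : Set X, IsCompact K ∧ m i Kᶜ ≤ ENNReal.ofReal (ε / 2) := by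
    intro i
    have := hm i
    obtain ⟨K, hK, h⟩ := isTightMeasureSet_iff_exists_isCompact_measure_compl_le.1
      (isTightMeasureSet_singleton (μ := m i)) (ENNReal.ofReal (ε / 2)) (by simpa using hε)
    exact ⟨K, hK, h _ rfl⟩
  choose K hKc hKm using htight
  let L : Set X := {x₀} ∪ ⋃ i ∈ Finset.range (N + 1), K i
  have hLc : IsCompact L :=
    isCompact_singleton.union ((Finset.range (N + 1)).isCompact_biUnion fun i _ => hKc i)
  have hLne : L.Nonempty := ⟨x₀, Or.inl rfl⟩
  have hLm : ∀ i ≤ N, m i Lᶜ ≤ ENNReal.ofReal (ε / 2) := by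
    intro i hi
    refine (measure_mono ?_).trans (hKm i)
    apply compl_subset_compl.2
    intro x hx
    refine Or.inr ?_
    simp only [mem_iUnion]
    exact ⟨i, by simpa using Nat.lt_succ_of_le hi, hx⟩
  refine ⟨L, hLc, fun n => ?_⟩
  rcases le_total n N with hn | hn
  · refine (measure_mono (compl_subset_compl.2 (Metric.self_subset_thickening hδ L))).trans
      ((hLm n hn).trans (ENNReal.ofReal_le_ofReal (by linarith)))
  have := hm n
  have := hm N
  let f : X → ℝ := fun x => min (Metric.infDist x L) δ
  have hf0 : ∀ x, 0 ≤ f x := fun x => le_min Metric.infDist_nonneg hδ.le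
  have hfδ : ∀ x, f x ≤ δ := fun x => min_le_right _ _
  have hfl : LipschitzWith 1 f := (Metric.lipschitz_infDist_pt L).min_const δ
  have hfb : ∀ x, |f x| ≤ δ := fun x => by rw [abs_of_nonneg (hf0 x)]; exact hfδ x
  have hfi : ∀ (ν : Measure X) [IsProbabilityMeasure ν], Integrable f ν := fun ν _ =>
    Integrable.of_bound hfl.continuous.aestronglyMeasurable δ (Eventually.of_forall hfb)
  have h1 := hN n hn f hfl ⟨δ, hfb⟩
  have h2 : ∫ x, f x ∂(m N) ≤ δ * (ε / 2) := by
    have hle : ∀ x, f x ≤ Lᶜ.indicator (fun _ => δ) x := by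
      intro x
      by_cases hx : x ∈ L
      · have : f x = 0 := by
          simp only [f, Metric.infDist_zero_of_mem hx]
          exact min_eq_left hδ.le
        simp [this, hx]
      · simp [hx, hfδ x]
    calc ∫ x, f x ∂(m N) ≤ ∫ x, Lᶜ.indicator (fun _ => δ) x ∂(m N) :=
          integral_mono (hfi _) ((integrable_const δ).indicator hLc.measurableSet.compl) hle
      _ = (m N).real Lᶜ * δ := by
          rw [integral_indicator hLc.measurableSet.compl]; simp
      _ ≤ (ε / 2) * δ := by
          gcongr
          exact ENNReal.toReal_le_of_le_ofReal (by positivity) (hLm N le_rfl)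
      _ = _ := by ring
  have h3 : ∫ x, f x ∂(m n) ≤ δ * ε := by
    have := (abs_le.1 h1).2
    linarith
  have h4 := mul_meas_ge_le_integral_of_nonneg (Eventually.of_forall hf0) (hfi (m n)) δ
  have h5 : (m n).real {x | δ ≤ f x} ≤ ε := le_of_mul_le_mul_left (h4.trans h3) hδ
  have h6 : (Metric.thickening δ L)ᶜ ⊆ {x | δ ≤ f x} := by
    intro x hx
    rw [mem_compl_iff, Metric.mem_thickening_iff_infDist_lt hLne, not_lt] at hx
    exact le_min hx le_rfl
  refine (measure_mono h6).trans ?_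
  rw [← ofReal_measureReal]
  exact ENNReal.ofReal_le_ofReal h5

lemma aux_tight (x₀ : X) (m : ℕ → Measure X) (hm : ∀ n, IsProbabilityMeasure (m n))
    (hC : ∀ ε : ℝ, 0 < ε → ∃ N : ℕ, ∀ n, N ≤ n → ∀ f : X → ℝ, LipschitzWith 1 f →
      (∃ C, ∀ x, |f x| ≤ C) → |(∫ x, f x ∂(m n)) - ∫ x, f x ∂(m N)| ≤ ε) :
    IsTightMeasureSet (range m) := by
  rw [isTightMeasureSet_iff_exists_isCompact_measure_compl_le]
  intro ε hε
  obtain ⟨e, he, hsum⟩ := ENNReal.exists_pos_sum_of_countable hε.ne' ℕ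
  have hs : ∀ k : ℕ, ∃ K : Set X, IsCompact K ∧
      ∀ n, m n (Metric.thickening (1 / ((k : ℝ) + 1)) K)ᶜ ≤ (e k : ℝ≥0∞) := by
    intro k
    obtain ⟨K, hK, h⟩ := aux_tight_step x₀ m hm hC (1 / ((k : ℝ) + 1)) (e k) (by positivity) (he k)
    refine ⟨K, hK, fun n => (h n).trans ?_⟩
    simp
  choose K hKc hKm using hs
  refine ⟨⋂ k : ℕ, Metric.cthickening (1 / ((k : ℝ) + 1)) (K k), ?_, ?_⟩
  · refine TotallyBounded.isCompact_of_isClosed ?_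
      (isClosed_iInter fun k => Metric.isClosed_cthickening)
    refine Metric.totallyBounded_iff.2 fun d hd => ?_
    obtain ⟨k, hk⟩ := exists_nat_one_div_lt (half_pos hd)
    obtain ⟨t, htf, ht⟩ := Metric.totallyBounded_iff.1 (hKc k).totallyBounded (d / 2) (half_pos hd)
    refine ⟨t, htf, fun x hx => ?_⟩
    have hx' := mem_iInter.1 hx k
    rw [(hKc k).cthickening_eq_biUnion_closedBall (by positivity)] at hx'
    simp only [mem_iUnion, Metric.mem_closedBall] at hx'
    obtain ⟨y, hy, hxy⟩ := hx'
    have hy' := ht hy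
    simp only [mem_iUnion, Metric.mem_ball] at hy' ⊢
    obtain ⟨z, hz, hyz⟩ := hy'
    refine ⟨z, hz, ?_⟩
    linarith [dist_triangle x y z]
  · rintro _ ⟨n, rfl⟩
    rw [compl_iInter]
    refine (measure_iUnion_le _).trans (le_trans (ENNReal.tsum_le_tsum fun k => ?_) hsum.le)
    exact (measure_mono (compl_subset_compl.2 (Metric.thickening_subset_cthickening _ _))).trans
      (hKm k n)

/-- A sequence of probability measures, Cauchy for Lipschitz test functions, has a weakly
convergent subsequence. -/
lemma aux_subseq (x₀ : X) (m : ℕ → Measure X) (hm : ∀ n, IsProbabilityMeasure (m n))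
    (hC : ∀ ε : ℝ, 0 < ε → ∃ N : ℕ, ∀ n, N ≤ n → ∀ f : X → ℝ, LipschitzWith 1 f →
      (∃ C, ∀ x, |f x| ≤ C) → |(∫ x, f x ∂(m n)) - ∫ x, f x ∂(m N)| ≤ ε) :
    ∃ (μs : Measure X) (φ : ℕ → ℕ), IsProbabilityMeasure μs ∧ StrictMono φ ∧
      ∀ f : X → ℝ, Continuous f → (∃ C, ∀ x, |f x| ≤ C) →
        Tendsto (fun n => ∫ x, f x ∂(m (φ n))) atTop (𝓝 (∫ x, f x ∂μs)) := by
  let p : ℕ → ProbabilityMeasure X := fun n => ⟨m n, hm n⟩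
  have ht : IsTightMeasureSet {((ν : ProbabilityMeasure X) : Measure X) | ν ∈ range p} := by
    refine (aux_tight x₀ m hm hC).subset ?_
    rintro _ ⟨_, ⟨n, rfl⟩, rfl⟩
    exact ⟨n, rfl⟩
  have hc := isCompact_closure_of_isTightMeasureSet ht
  obtain ⟨q, -, φ, hφ, hq⟩ := hc.isSeqCompact (fun n => subset_closure (mem_range_self (f := p) n))
  refine ⟨q, φ, inferInstance, hφ, ?_⟩
  rintro f hf ⟨C, hCb⟩
  have := (ProbabilityMeasure.tendsto_iff_forall_integral_tendsto.1 hq)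
    (BoundedContinuousFunction.ofNormedAddCommGroup f hf C hCb)
  exact this

lemma aux_meas {P : ℝ → X → Measure X} (hP : IsMarkovSemigroup P) (t : ℝ) : Measurable (P t) :=
  Measure.measurable_of_measurable_coe _ fun A hA =>
    (hP.jointMeas A hA).comp (measurable_const.prodMk measurable_id)

lemma aux_prob {P : ℝ → X → Measure X} (hP : IsMarkovSemigroup P) {t : ℝ} (ht : 0 ≤ t)
    (ν : Measure X) [IsProbabilityMeasure ν] : IsProbabilityMeasure (measAct P t ν) := by
  constructor
  have : ∀ x, P t x univ = 1 := fun x => (hP.prob t ht x).measure_univ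
  rw [measAct, Measure.bind_apply MeasurableSet.univ (aux_meas hP t).aemeasurable]
  simp [this]

lemma aux_integral {P : ℝ → X → Measure X} (hP : IsMarkovSemigroup P) (t : ℝ)
    (ν : Measure X) (f : X → ℝ) (hf : Integrable f (measAct P t ν)) :
    Integrable (funAct P t f) ν ∧ ∫ x, f x ∂(measAct P t ν) = ∫ x, funAct P t f x ∂ν := by
  let η : ProbabilityTheory.Kernel X X := ⟨P t, aux_meas hP t⟩
  let κ : ProbabilityTheory.Kernel Unit X := ProbabilityTheory.Kernel.const Unit ν
  have h : (η.comp κ) () = measAct P t ν := by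
    rw [ProbabilityTheory.Kernel.comp_apply]; rfl
  rw [← h] at hf ⊢
  exact ⟨hf.integral_comp, ProbabilityTheory.Kernel.integral_comp hf⟩

lemma aux_zero {P : ℝ → X → Measure X} (hP : IsMarkovSemigroup P) (ν : Measure X) :
    measAct P 0 ν = ν := by
  have : P 0 = Measure.dirac := funext hP.init
  rw [measAct, this, Measure.bind_dirac]

lemma aux_add {P : ℝ → X → Measure X} (hP : IsMarkovSemigroup P) {s t : ℝ} (hs : 0 ≤ s)
    (ht : 0 ≤ t) (ν : Measure X) :
    measAct P (s + t) ν = measAct P t (measAct P s ν) := by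
  have : P (s + t) = fun x => (P s x).bind (P t) := funext (hP.chapman s t hs ht)
  rw [measAct, measAct, measAct, this,
    Measure.bind_bind (aux_meas hP s).aemeasurable (aux_meas hP t).aemeasurable]

lemma aux_ffm {P : ℝ → X → Measure X} (hP : IsMarkovSemigroup P) {γ : ℝ} (hA3 : CondA3 P γ)
    {t : ℝ} (ht : 0 ≤ t) (ν : Measure X) [IsProbabilityMeasure ν] (hν : FiniteFirstMoment ν) :
    FiniteFirstMoment (measAct P t ν) := by
  rcases ht.eq_or_lt with rfl | h
  · rwa [aux_zero hP]
  · exact hA3.1 ν inferInstance hν t h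

lemma aux_ffm_pt {P : ℝ → X → Measure X} (hP : IsMarkovSemigroup P) {γ : ℝ} (hA3 : CondA3 P γ)
    {t : ℝ} (ht : 0 ≤ t) (x : X) : FiniteFirstMoment (P t x) := by
  have h := aux_ffm hP hA3 ht (Measure.dirac x) (fun y => integrable_dirac (by simp))
  rwa [measAct, Measure.dirac_bind (aux_meas hP t)] at h

lemma aux_lip_int {f : X → ℝ} {L : ℝ≥0} (hf : LipschitzWith L f) (ν : Measure X)
    [IsProbabilityMeasure ν] (hν : FiniteFirstMoment ν) : Integrable f ν := by
  rcases isEmpty_or_nonempty X with h | ⟨⟨x₀⟩⟩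
  · have : f = fun _ => 0 := funext fun x => h.elim x
    rw [this]; exact integrable_zero _ _ _
  refine Integrable.mono' (((hν x₀).const_mul L).add (integrable_const |f x₀|))
    hf.continuous.aestronglyMeasurable (Eventually.of_forall fun x => ?_)
  have h := hf.dist_le_mul x x₀
  rw [Real.dist_eq, dist_comm] at h
  have h2 := abs_sub_abs_le_abs_sub (f x) (f x₀)
  simp only [Real.norm_eq_abs, Pi.add_apply]
  linarith

lemma aux_lip_diff {f : X → ℝ} {L : ℝ≥0} (hf : LipschitzWith L f) (x₀ : X) (ν₁ ν₂ : Measure X)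
    [IsProbabilityMeasure ν₁] [IsProbabilityMeasure ν₂] (h₁ : FiniteFirstMoment ν₁)
    (h₂ : FiniteFirstMoment ν₂) :
    |(∫ x, f x ∂ν₁) - ∫ x, f x ∂ν₂| ≤ L * ((∫ x, dist x₀ x ∂ν₁) + ∫ x, dist x₀ x ∂ν₂) := by
  have key : ∀ (ν : Measure X) [IsProbabilityMeasure ν], FiniteFirstMoment ν →
      |(∫ x, f x ∂ν) - f x₀| ≤ L * ∫ x, dist x₀ x ∂ν := by
    intro ν _ hν
    have e : (∫ x, f x ∂ν) - f x₀ = ∫ x, (f x - f x₀) ∂ν := by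
      rw [integral_sub (aux_lip_int hf ν hν) (integrable_const _)]; simp
    rw [e, ← integral_const_mul, ← Real.norm_eq_abs]
    refine norm_integral_le_of_norm_le ((hν x₀).const_mul _) (Eventually.of_forall fun x => ?_)
    have h := hf.dist_le_mul x x₀
    rwa [dist_comm x, Real.dist_eq] at h
  have a := abs_le.1 (key ν₁ h₁)
  have b := abs_le.1 (key ν₂ h₂)
  rw [abs_le, mul_add]
  constructor <;> linarith [a.1, a.2, b.1, b.2]

lemma aux_wass {f : X → ℝ} (hf : LipschitzWith 1 f) (ν₁ ν₂ : Measure X)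
    [IsProbabilityMeasure ν₁] [IsProbabilityMeasure ν₂] (h₁ : FiniteFirstMoment ν₁)
    (h₂ : FiniteFirstMoment ν₂) :
    |(∫ x, f x ∂ν₁) - ∫ x, f x ∂ν₂| ≤ wassDist ν₁ ν₂ := by
  rcases isEmpty_or_nonempty X with h | ⟨⟨x₀⟩⟩
  · have h1 : ν₁ univ = 1 := measure_univ
    rw [univ_eq_empty_iff.2 h, measure_empty] at h1
    exact absurd h1 (by simp)
  refine le_csSup ⟨(∫ x, dist x₀ x ∂ν₁) + ∫ x, dist x₀ x ∂ν₂, ?_⟩ ⟨f, hf, rfl⟩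
  rintro _ ⟨g, hg, rfl⟩
  simpa using aux_lip_diff hg x₀ ν₁ ν₂ h₁ h₂

lemma aux_lip {P : ℝ → X → Measure X} (hP : IsMarkovSemigroup P) {γ : ℝ} (hA3 : CondA3 P γ)
    {t : ℝ} (ht : 0 ≤ t) {f : X → ℝ} (hf : LipschitzWith 1 f) :
    LipschitzWith (Real.toNNReal (Real.exp (-γ * t))) (funAct P t f) := by
  refine LipschitzWith.of_dist_le_mul fun x y => ?_
  rw [Real.dist_eq, Real.coe_toNNReal _ (Real.exp_pos _).le]
  have := hP.prob t ht x
  have := hP.prob t ht y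
  exact (aux_wass hf _ _ (aux_ffm_pt hP hA3 ht x) (aux_ffm_pt hP hA3 ht y)).trans
    (hA3.2.2 t ht x y)

lemma aux_contr {P : ℝ → X → Measure X} (hP : IsMarkovSemigroup P) {γ : ℝ} (hA3 : CondA3 P γ)
    {t : ℝ} (ht : 0 ≤ t) {f : X → ℝ} (hf : LipschitzWith 1 f) (x₀ : X) (ν₁ ν₂ : Measure X)
    [IsProbabilityMeasure ν₁] [IsProbabilityMeasure ν₂] (h₁ : FiniteFirstMoment ν₁)
    (h₂ : FiniteFirstMoment ν₂) :
    |(∫ x, f x ∂(measAct P t ν₁)) - ∫ x, f x ∂(measAct P t ν₂)| ≤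
      Real.exp (-γ * t) * ((∫ x, dist x₀ x ∂ν₁) + ∫ x, dist x₀ x ∂ν₂) := by
  have := aux_prob hP ht ν₁
  have := aux_prob hP ht ν₂
  rw [(aux_integral hP t ν₁ f (aux_lip_int hf _ (aux_ffm hP hA3 ht ν₁ h₁))).2,
    (aux_integral hP t ν₂ f (aux_lip_int hf _ (aux_ffm hP hA3 ht ν₂ h₂))).2]
  have h := aux_lip_diff (aux_lip hP hA3 ht hf) x₀ ν₁ ν₂ h₁ h₂
  rwa [Real.coe_toNNReal _ (Real.exp_pos _).le] at h

/-- Finite `ζ`-th moment yields finite first moment, with a bound. -/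
lemma aux_moment {ζ : ℝ} (hζ : 2 < ζ) (x₀ : X) (M : ℝ) (ν : Measure X) [IsProbabilityMeasure ν]
    (h : ∫⁻ x, ENNReal.ofReal (dist x₀ x ^ ζ) ∂ν ≤ ENNReal.ofReal M) :
    FiniteFirstMoment ν ∧ ∫ x, dist x₀ x ∂ν ≤ 1 + max M 0 := by
  have hpt : ∀ x, dist x₀ x ≤ 1 + dist x₀ x ^ ζ := by
    intro x
    rcases le_total (dist x₀ x) 1 with h1 | h1
    · have : 0 ≤ dist x₀ x ^ ζ := by positivity
      linarith
    · have := Real.self_le_rpow_of_one_le h1 (by linarith : 1 ≤ ζ)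
      linarith
  have hl : ∫⁻ x, ENNReal.ofReal (dist x₀ x) ∂ν ≤ ENNReal.ofReal (1 + max M 0) := by
    calc ∫⁻ x, ENNReal.ofReal (dist x₀ x) ∂ν
        ≤ ∫⁻ x, (1 + ENNReal.ofReal (dist x₀ x ^ ζ)) ∂ν := by
          refine lintegral_mono fun x => ?_
          rw [← ENNReal.ofReal_one, ← ENNReal.ofReal_add zero_le_one (by positivity)]
          exact ENNReal.ofReal_le_ofReal (hpt x)
      _ = 1 + ∫⁻ x, ENNReal.ofReal (dist x₀ x ^ ζ) ∂ν := by
          rw [lintegral_add_left measurable_const]; simp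
      _ ≤ 1 + ENNReal.ofReal M := by gcongr
      _ ≤ ENNReal.ofReal (1 + max M 0) := by
          rw [ENNReal.ofReal_add zero_le_one (le_max_right _ _), ENNReal.ofReal_one]
          gcongr
          exact le_max_left _ _
  have hc : ∀ y : X, Continuous fun x => dist y x := fun y => by fun_prop
  have hi : Integrable (fun x => dist x₀ x) ν := by
    refine ⟨(hc x₀).aestronglyMeasurable, ?_⟩
    rw [hasFiniteIntegral_iff_ofReal (Eventually.of_forall fun x => dist_nonneg)]
    exact hl.trans_lt ENNReal.ofReal_lt_top
  refine ⟨fun y => ?_, ?_⟩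
  · refine Integrable.mono' (hi.add (integrable_const (dist y x₀))) (hc y).aestronglyMeasurable
      (Eventually.of_forall fun x => ?_)
    simp only [Real.norm_eq_abs, Pi.add_apply, abs_of_nonneg dist_nonneg]
    linarith [dist_triangle y x₀ x]
  · rw [integral_eq_lintegral_of_nonneg_ae (Eventually.of_forall fun x => dist_nonneg)
      (hc x₀).aestronglyMeasurable]
    exact ENNReal.toReal_le_of_le_ofReal (by positivity) hl

/-- Weak limits do not increase the moment bound. -/
lemma aux_fatou {ζ : ℝ} (hζ : 0 < ζ) (x₀ : X) (M : ℝ) (m : ℕ → Measure X) (μs : Measure X)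
    [IsProbabilityMeasure μs] (hm : ∀ n, IsProbabilityMeasure (m n))
    (hM : ∀ n, ∫⁻ x, ENNReal.ofReal (dist x₀ x ^ ζ) ∂(m n) ≤ ENNReal.ofReal M)
    (hlim : ∀ f : X → ℝ, Continuous f → (∃ C, ∀ x, |f x| ≤ C) →
        Tendsto (fun n => ∫ x, f x ∂(m n)) atTop (𝓝 (∫ x, f x ∂μs))) :
    ∫⁻ x, ENNReal.ofReal (dist x₀ x ^ ζ) ∂μs ≤ ENNReal.ofReal M := by
  have hc : Continuous fun x => dist x₀ x ^ ζ :=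
    (continuous_const.dist continuous_id).rpow_const fun x => Or.inr hζ.le
  have hcut : ∀ k : ℕ, ∫⁻ x, ENNReal.ofReal (min (dist x₀ x ^ ζ) k) ∂μs ≤ ENNReal.ofReal M := by
    intro k
    have hck : Continuous fun x => min (dist x₀ x ^ ζ) (k : ℝ) := hc.min continuous_const
    have h0 : ∀ x, 0 ≤ min (dist x₀ x ^ ζ) (k : ℝ) := fun x => le_min (by positivity) (by positivity)
    have hb : ∀ x, |min (dist x₀ x ^ ζ) (k : ℝ)| ≤ k := fun x => by
      rw [abs_of_nonneg (h0 x)]; exact min_le_right _ _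
    have hi : ∀ (ν : Measure X) [IsProbabilityMeasure ν],
        Integrable (fun x => min (dist x₀ x ^ ζ) (k : ℝ)) ν := fun ν _ =>
      Integrable.of_bound hck.aestronglyMeasurable k (Eventually.of_forall hb)
    have ht := (ENNReal.continuous_ofReal.tendsto _).comp (hlim _ hck ⟨k, hb⟩)
    rw [ofReal_integral_eq_lintegral_ofReal (hi μs) (Eventually.of_forall h0)] at ht
    refine le_of_tendsto ht (Eventually.of_forall fun n => ?_)
    have := hm n
    simp only [Function.comp_apply]
    rw [ofReal_integral_eq_lintegral_ofReal (hi (m n)) (Eventually.of_forall h0)]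
    exact (lintegral_mono fun x => ENNReal.ofReal_le_ofReal (min_le_left _ _)).trans (hM n)
  have hT : Tendsto (fun k : ℕ => ∫⁻ x, ENNReal.ofReal (min (dist x₀ x ^ ζ) k) ∂μs) atTop
      (𝓝 (∫⁻ x, ENNReal.ofReal (dist x₀ x ^ ζ) ∂μs)) := by
    refine lintegral_tendsto_of_tendsto_of_monotone
      (fun k => (hc.min continuous_const).measurable.ennreal_ofReal.aemeasurable)
      (Eventually.of_forall fun x k l hkl => ?_) (Eventually.of_forall fun x => ?_)
    · refine ENNReal.ofReal_le_ofReal (min_le_min le_rfl ?_)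
      exact_mod_cast hkl
    · refine tendsto_const_nhds.congr' ?_
      obtain ⟨N, hN⟩ := exists_nat_ge (dist x₀ x ^ ζ)
      filter_upwards [eventually_ge_atTop N] with k hk
      rw [min_eq_left]
      exact hN.trans (by exact_mod_cast hk)
  exact le_of_tendsto hT (Eventually.of_forall hcut)

/-- A bounded Lipschitz function is a multiple of a bounded 1-Lipschitz function. -/
lemma aux_scale (x₀ : X) {f : X → ℝ} (hb : ∃ C : ℝ, ∀ x y, dist (f x) (f y) ≤ C)
    (hL : ∃ L, LipschitzWith L f) :
    ∃ (c : ℝ) (g : X → ℝ), 0 < c ∧ LipschitzWith 1 g ∧ (∃ C, ∀ x, |g x| ≤ C) ∧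
      f = fun x => c * g x := by
  obtain ⟨L, hL⟩ := hL
  obtain ⟨C, hC⟩ := hb
  refine ⟨L + 1, fun x => (L + 1 : ℝ)⁻¹ * f x, by positivity, ?_,
    ⟨(L + 1 : ℝ)⁻¹ * (|f x₀| + C), fun x => ?_⟩, ?_⟩
  · refine LipschitzWith.of_dist_le_mul fun x y => ?_
    have h := hL.dist_le_mul x y
    rw [Real.dist_eq] at h ⊢
    rw [← mul_sub, abs_mul, abs_of_pos (by positivity), NNReal.coe_one, one_mul,
      inv_mul_le_iff₀ (by positivity)]
    have : 0 ≤ dist x y := dist_nonneg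
    linarith
  · rw [abs_mul, abs_of_pos (by positivity : (0 : ℝ) < (L + 1 : ℝ)⁻¹)]
    gcongr
    have h1 := hC x x₀
    rw [Real.dist_eq] at h1
    linarith [abs_sub_abs_le_abs_sub (f x) (f x₀)]
  · funext x
    have : (L + 1 : ℝ) ≠ 0 := by positivity
    field_simp

lemma aux_ext (x₀ : X) (ν₁ ν₂ : Measure X) [IsProbabilityMeasure ν₁] [IsProbabilityMeasure ν₂]
    (h : ∀ g : X → ℝ, LipschitzWith 1 g → (∃ C, ∀ x, |g x| ≤ C) →
      ∫ x, g x ∂ν₁ = ∫ x, g x ∂ν₂) : ν₁ = ν₂ := by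
  let p₁ : ProbabilityMeasure X := ⟨ν₁, inferInstance⟩
  let p₂ : ProbabilityMeasure X := ⟨ν₂, inferInstance⟩
  have ht : Tendsto (fun _ : ℕ => p₁) atTop (𝓝 p₂) := by
    rw [tendsto_iff_forall_lipschitz_integral_tendsto]
    intro f hb hL
    obtain ⟨c, g, -, hg, hgb, rfl⟩ := aux_scale x₀ hb hL
    have e : ∫ x, c * g x ∂ν₁ = ∫ x, c * g x ∂ν₂ := by
      rw [integral_const_mul, integral_const_mul, h g hg hgb]
    change Tendsto (fun _ : ℕ => ∫ x, c * g x ∂ν₁) atTop (𝓝 (∫ x, c * g x ∂ν₂))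
    rw [e]
    exact tendsto_const_nhds
  have : p₁ = p₂ := tendsto_nhds_unique tendsto_const_nhds ht
  exact congrArg (fun p : ProbabilityMeasure X => (p : Measure X)) this

lemma aux_exp {γ : ℝ} (hγ : 0 < γ) (c : ℝ) :
    Tendsto (fun t : ℝ => Real.exp (-γ * t) * c) atTop (𝓝 0) := by
  have h : Tendsto (fun t : ℝ => -γ * t) atTop atBot :=
    tendsto_id.const_mul_atTop_of_neg (by linarith)
  simpa using (Real.tendsto_exp_atBot.comp h).mul_const c

/-- Asymptotic stability, given an invariant measure with finite first moment. -/
lemma aux_stable {P : ℝ → X → Measure X} (hP : IsMarkovSemigroup P) {γ : ℝ} (hA3 : CondA3 P γ)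
    (x₀ : X) (μs : Measure X) [IsProbabilityMeasure μs] (hμs : FiniteFirstMoment μs)
    (hinv : ∀ t, 0 ≤ t → measAct P t μs = μs) (ν : Measure X) [IsProbabilityMeasure ν]
    (f : X → ℝ) (hf : Continuous f) (hfb : ∃ C, ∀ x, |f x| ≤ C) :
    Tendsto (fun t : ℝ => ∫ x, f x ∂(measAct P t ν)) atTop (𝓝 (∫ x, f x ∂μs)) := by
  have hpr : ∀ t : ℝ, IsProbabilityMeasure (measAct P (max t 0) ν) :=
    fun t => aux_prob hP (le_max_right _ _) ν
  let p : ℝ → ProbabilityMeasure X := fun t => ⟨measAct P (max t 0) ν, hpr t⟩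
  let q : ProbabilityMeasure X := ⟨μs, inferInstance⟩
  have hev : ∀ g : X → ℝ, (fun t : ℝ => ∫ x, g x ∂(measAct P (max t 0) ν)) =ᶠ[atTop]
      fun t : ℝ => ∫ x, g x ∂(measAct P t ν) := by
    intro g
    filter_upwards [eventually_ge_atTop 0] with t ht
    rw [max_eq_left ht]
  have ht : Tendsto p atTop (𝓝 q) := by
    rw [tendsto_iff_forall_lipschitz_integral_tendsto]
    intro f hb hL
    obtain ⟨c, g, -, hg, ⟨C, hC⟩, rfl⟩ := aux_scale x₀ hb hL
    change Tendsto (fun t : ℝ => ∫ x, c * g x ∂(measAct P (max t 0) ν)) atTop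
      (𝓝 (∫ x, c * g x ∂μs))
    simp_rw [integral_const_mul]
    refine Tendsto.const_mul c (Tendsto.congr' (hev g).symm ?_)
    have hgi : ∀ (ν : Measure X) [IsProbabilityMeasure ν], Integrable g ν := fun ν _ =>
      Integrable.of_bound hg.continuous.aestronglyMeasurable C (Eventually.of_forall hC)
    have hmain : Tendsto (fun t : ℝ => ∫ x, funAct P t g x ∂ν) atTop
        (𝓝 (∫ _, (∫ x, g x ∂μs) ∂ν)) := by
      refine tendsto_integral_filter_of_dominated_convergence (fun _ => C) ?_ ?_
        (integrable_const _) (Eventually.of_forall fun x => ?_)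
      · filter_upwards [eventually_ge_atTop 0] with t ht
        exact (aux_lip hP hA3 ht hg).continuous.aestronglyMeasurable
      · filter_upwards [eventually_ge_atTop 0] with t ht
        refine Eventually.of_forall fun x => ?_
        have := hP.prob t ht x
        have h := norm_integral_le_of_norm_le_const (μ := P t x) (f := g)
          (Eventually.of_forall hC)
        simpa [funAct] using h
      · rw [tendsto_iff_dist_tendsto_zero]
        refine squeeze_zero' (Eventually.of_forall fun _ => dist_nonneg) ?_
          (aux_exp hA3.2.1 ((∫ y, dist x₀ y ∂(Measure.dirac x)) + ∫ y, dist x₀ y ∂μs))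
        filter_upwards [eventually_ge_atTop 0] with t ht
        have h := aux_contr hP hA3 ht hg x₀ (Measure.dirac x) μs
          (fun y => integrable_dirac (by simp)) hμs
        rw [hinv t ht, measAct, Measure.dirac_bind (aux_meas hP t)] at h
        exact h
    rw [integral_const, probReal_univ, one_smul] at hmain
    refine hmain.congr' ?_
    filter_upwards [eventually_ge_atTop 0] with t ht
    have := aux_prob hP ht ν
    exact ((aux_integral hP t ν g (hgi _)).2).symm
  obtain ⟨C, hC⟩ := hfb
  have := (ProbabilityMeasure.tendsto_iff_forall_integral_tendsto.1 ht)
    (BoundedContinuousFunction.ofNormedAddCommGroup f hf C hC)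
  exact Tendsto.congr' (hev f) this

/-- Proposition 1. Under (A2)–(A4) the semigroup has a unique invariant
probability measure `μ_*` with finite `ζ`-th moment; it is asymptotically stable, and
exponential ergodicity in the Wasserstein distance holds. -/
theorem exists_unique_invariant_measure
    (P : ℝ → X → Measure X) (hP : IsMarkovSemigroup P)
    (γ ζ : ℝ) (x₀ : X) (μ : Measure X) [IsProbabilityMeasure μ]
    (hA2 : CondA2 P) (hA3 : CondA3 P γ) (hA4 : CondA4 P μ x₀ ζ) :
    ∃ μstar : Measure X, IsProbabilityMeasure μstar ∧
      (∀ t, 0 ≤ t → measAct P t μstar = μstar) ∧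
      (∀ ν : Measure X, IsProbabilityMeasure ν →
        (∀ t, 0 ≤ t → measAct P t ν = ν) → ν = μstar) ∧
      (∫⁻ x, ENNReal.ofReal (dist x₀ x ^ ζ) ∂μstar) < ⊤ ∧
      (∀ ν : Measure X, IsProbabilityMeasure ν →
        ∀ f : X → ℝ, Continuous f → (∃ C, ∀ x, |f x| ≤ C) →
          Tendsto (fun t : ℝ => ∫ x, f x ∂(measAct P t ν)) atTop (𝓝 (∫ x, f x ∂μstar))) ∧
      ∃ C : ℝ, 0 < C ∧ ∀ t, 0 ≤ t → ∀ ν : Measure X, IsProbabilityMeasure ν →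
        FiniteFirstMoment ν →
          wassDist (measAct P t ν) μstar ≤
            C * Real.exp (-γ * t) * ((∫ x, dist x₀ x ∂ν) + 1) := by
  obtain ⟨hζ, M, hM⟩ := hA4
  have hγ := hA3.2.1
  set K : ℝ := 1 + max M 0 with hK
  have hKpos : 0 < K := by positivity
  have hpr : ∀ t : ℝ, 0 ≤ t → IsProbabilityMeasure (measAct P t μ) := fun t ht => aux_prob hP ht μ
  have hmom : ∀ t : ℝ, 0 ≤ t → FiniteFirstMoment (measAct P t μ) ∧
      ∫ x, dist x₀ x ∂(measAct P t μ) ≤ K := by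
    intro t ht
    have := hpr t ht
    exact aux_moment hζ x₀ M _ (hM t ht)
  have hμ : FiniteFirstMoment μ ∧ ∫ x, dist x₀ x ∂μ ≤ K := by
    have := hmom 0 le_rfl
    rwa [aux_zero hP] at this
  have hcauchy : ∀ s r : ℝ, 0 ≤ s → 0 ≤ r → ∀ f : X → ℝ, LipschitzWith 1 f →
      |(∫ x, f x ∂(measAct P (r + s) μ)) - ∫ x, f x ∂(measAct P s μ)| ≤
        Real.exp (-γ * s) * (2 * K) := by
    intro s r hs hr f hf
    have := hpr r hr
    rw [aux_add hP hr hs]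
    refine (aux_contr hP hA3 hs hf x₀ _ μ (hmom r hr).1 hμ.1).trans ?_
    have h1 := (hmom r hr).2
    have h2 := hμ.2
    gcongr
    linarith
  have hexp := aux_exp hγ (2 * K)
  obtain ⟨μs, φ, hμsp, hφ, hlim⟩ := aux_subseq x₀ (fun n : ℕ => measAct P n μ)
    (fun n => hpr n n.cast_nonneg) (by
      intro ε hε
      obtain ⟨N, hN⟩ := ((hexp.comp tendsto_natCast_atTop_atTop).eventually_lt_const hε).exists
      refine ⟨N, fun n hn f hf _ => ?_⟩
      have h := hcauchy N (n - N) N.cast_nonneg (sub_nonneg.2 (by exact_mod_cast hn)) f hf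
      rw [sub_add_cancel] at h
      exact h.trans hN.le)
  have hμsm : ∫⁻ x, ENNReal.ofReal (dist x₀ x ^ ζ) ∂μs ≤ ENNReal.ofReal M :=
    aux_fatou (by linarith) x₀ M (fun n => measAct P (φ n : ℕ) μ) μs
      (fun n => hpr _ (Nat.cast_nonneg _)) (fun n => hM _ (Nat.cast_nonneg _)) hlim
  have hμsf := aux_moment hζ x₀ M μs hμsm
  have hinv : ∀ t, 0 ≤ t → measAct P t μs = μs := by
    intro t ht
    have := aux_prob hP ht μs
    refine aux_ext x₀ _ _ fun g hg hgb => ?_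
    have hgi : ∀ (ν : Measure X) [IsProbabilityMeasure ν], Integrable g ν := by
      intro ν _
      obtain ⟨C, hC⟩ := hgb
      exact Integrable.of_bound hg.continuous.aestronglyMeasurable C (Eventually.of_forall hC)
    rw [(aux_integral hP t μs g (hgi _)).2]
    obtain ⟨hc, hb⟩ := hA2 g hg.continuous hgb t ht
    have h1 := hlim _ hc hb
    have h2 := hlim _ hg.continuous hgb
    have h3 := (h1.sub h2).abs
    have hφt : Tendsto (fun n => ((φ n : ℕ) : ℝ)) atTop atTop :=
      tendsto_natCast_atTop_atTop.comp hφ.tendsto_atTop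
    have h4 : Tendsto (fun n => |(∫ x, funAct P t g x ∂(measAct P (φ n : ℕ) μ)) -
        ∫ x, g x ∂(measAct P (φ n : ℕ) μ)|) atTop (𝓝 0) := by
      refine squeeze_zero (fun _ => abs_nonneg _) (fun n => ?_) (hexp.comp hφt)
      have hn : (0 : ℝ) ≤ (φ n : ℕ) := Nat.cast_nonneg _
      have h := hcauchy (φ n : ℕ) t hn ht g hg
      have := hpr _ hn
      have := aux_prob hP ht (measAct P (φ n : ℕ) μ)
      rw [add_comm, aux_add hP hn ht, (aux_integral hP t _ g (hgi _)).2] at h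
      exact h
    have h5 := tendsto_nhds_unique h3 h4
    exact sub_eq_zero.1 (abs_eq_zero.1 h5)
  have hstab : ∀ ν : Measure X, IsProbabilityMeasure ν →
        ∀ f : X → ℝ, Continuous f → (∃ C, ∀ x, |f x| ≤ C) →
          Tendsto (fun t : ℝ => ∫ x, f x ∂(measAct P t ν)) atTop (𝓝 (∫ x, f x ∂μs)) :=
    fun ν _ f hf hb => aux_stable hP hA3 x₀ μs hμsf.1 hinv ν f hf hb
  refine ⟨μs, hμsp, hinv, ?_, hμsm.trans_lt ENNReal.ofReal_lt_top, hstab, K, hKpos, ?_⟩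
  · intro ν hν hνinv
    refine aux_ext x₀ _ _ fun g hg hgb => ?_
    refine tendsto_nhds_unique (tendsto_const_nhds.congr' ?_) (hstab ν hν g hg.continuous hgb)
    filter_upwards [eventually_ge_atTop 0] with t ht
    rw [hνinv t ht]
  · intro t ht ν hν hνf
    have hV : 0 ≤ ∫ x, dist x₀ x ∂ν := integral_nonneg fun x => dist_nonneg
    refine csSup_le ⟨_, fun _ => 0, LipschitzWith.const' 0, rfl⟩ ?_
    rintro _ ⟨f, hf, rfl⟩
    have h := aux_contr hP hA3 ht hf x₀ ν μs hνf hμsf.1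
    rw [hinv t ht] at h
    refine h.trans ?_
    rw [mul_comm K, mul_assoc]
    have h1 := hμsf.2
    have hK1 : 1 ≤ K := by rw [hK]; linarith [le_max_right M 0]
    gcongr
    nlinarith

end
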